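/- For all but finitely many integers a, the polynomial X⁴ + aX³ + (1 − a)X − 1 is irreducible over ℚ and the Galois group of its splitting field over ℚ is isomorphic to the symmetric group S₄ on four letters. -/

import Mathlib

open Polynomial

/-- The resolvent cubic of `X⁴ + bX³ + cX² + dX + e`. -/
def quarticResolvent {R : Type*} [CommRing R] (b c d e : R) : Cubic R :=
  ⟨1, -c, b * d - 4 * e, 4 * c * e - b ^ 2 * e - d ^ 2⟩

theorem map_quarticResolvent {R S : Type*} [CommRing R] [CommRing S] (f : R →+* S) (b c d e : R) :
    (quarticResolvent b c d e).map f = quarticResolvent (f b) (f c) (f d) (f e) := by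
  simp [quarticResolvent, Cubic.map, map_ofNat f]

theorem Cubic.discr_map {R S : Type*} [CommRing R] [CommRing S] (f : R →+* S) (P : Cubic R) :
    (P.map f).discr = f P.discr := by
  simp [Cubic.discr, Cubic.map, map_ofNat f]

theorem monic_quartic_coeffs_eq {R : Type*} [CommRing R] {b c d e b' c' d' e' : R}
    (h : (X ^ 4 + C b * X ^ 3 + C c * X ^ 2 + C d * X + C e : R[X]) =
      X ^ 4 + C b' * X ^ 3 + C c' * X ^ 2 + C d' * X + C e') :
    b = b' ∧ c = c' ∧ d = d' ∧ e = e' := by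
  refine ⟨?_, ?_, ?_, ?_⟩
  · simpa [coeff_X, coeff_C] using congrArg (coeff · 3) h
  · simpa [coeff_X, coeff_C] using congrArg (coeff · 2) h
  · simpa [coeff_X, coeff_C] using congrArg (coeff · 1) h
  · simpa [coeff_X, coeff_C] using congrArg (coeff · 0) h

/-- The Vieta relations for a monic quartic. -/
theorem quartic_vieta {R : Type*} [CommRing R] {b c d e : R} {x : Fin 4 → R}
    (h : X ^ 4 + C b * X ^ 3 + C c * X ^ 2 + C d * X + C e = ∏ i, (X - C (x i))) :
    b = -(x 0 + x 1 + x 2 + x 3) ∧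
    c = x 0 * x 1 + x 0 * x 2 + x 0 * x 3 + x 1 * x 2 + x 1 * x 3 + x 2 * x 3 ∧
    d = -(x 0 * x 1 * x 2 + x 0 * x 1 * x 3 + x 0 * x 2 * x 3 + x 1 * x 2 * x 3) ∧
    e = x 0 * x 1 * x 2 * x 3 := by
  refine monic_quartic_coeffs_eq (h.trans ?_)
  simp only [Fin.prod_univ_four, map_neg, map_add, map_mul]
  ring

/-- The discriminant of the resolvent cubic is the square of the Vandermonde determinant of the
roots of the quartic. -/
theorem discr_quarticResolvent_eq {R : Type*} [CommRing R] {b c d e : R} {x : Fin 4 → R}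
    (h : X ^ 4 + C b * X ^ 3 + C c * X ^ 2 + C d * X + C e = ∏ i, (X - C (x i))) :
    (quarticResolvent b c d e).discr = (Matrix.vandermonde x).det ^ 2 := by
  obtain ⟨rfl, rfl, rfl, rfl⟩ := quartic_vieta h
  have hdet : (Matrix.vandermonde x).det =
      (x 1 - x 0) * (x 2 - x 0) * (x 3 - x 0) * (x 2 - x 1) * (x 3 - x 1) * (x 3 - x 2) := by
    rw [Matrix.det_vandermonde]
    have h0 : Finset.Ioi (0 : Fin 4) = {1, 2, 3} := by decide
    have h1 : Finset.Ioi (1 : Fin 4) = {2, 3} := by decide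
    have h2 : Finset.Ioi (2 : Fin 4) = {3} := by decide
    have h3 : Finset.Ioi (3 : Fin 4) = ∅ := by decide
    simp [Fin.prod_univ_four, h0, h1, h2, h3]
    ring
  rw [hdet]
  simp only [quarticResolvent, Cubic.discr]
  ring

theorem eval_quarticResolvent_eq_zero {R : Type*} [CommRing R] {b c d e : R} {x : Fin 4 → R}
    (h : X ^ 4 + C b * X ^ 3 + C c * X ^ 2 + C d * X + C e = ∏ i, (X - C (x i))) :
    (quarticResolvent b c d e).toPoly.eval (x 0 * x 1 + x 2 * x 3) = 0 := by
  obtain ⟨rfl, rfl, rfl, rfl⟩ := quartic_vieta h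
  simp only [quarticResolvent, Cubic.toPoly, eval_add, eval_mul, eval_C, eval_pow, eval_X]
  ring

theorem Polynomial.Monic.natDegree_dvd_finrank_of_irreducible {F L : Type*} [Field F] [Field L]
    [Algebra F L] {p : F[X]} (hm : p.Monic) (hp : Irreducible p) {y : L}
    (hy : aeval y p = 0) : p.natDegree ∣ Module.finrank F L := by
  rw [minpoly.eq_of_irreducible_of_monic hp hy hm]
  exact minpoly.degree_dvd ⟨p, hm, by rwa [← aeval_def]⟩

/-- A family listing the roots of a polynomial defines a permutation representation of the
automorphism group. -/
theorem exists_galois_perm_hom {F L ι : Type*} [Field F] [Field L] [Algebra F L] [Fintype ι]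
    {p : F[X]} {x : ι → L} (hx : Function.Injective x)
    (hp : p.map (algebraMap F L) = ∏ i, (X - C (x i))) :
    ∃ φ : Gal(L/F) →* Equiv.Perm ι, ∀ σ i, x (φ σ i) = σ (x i) := by
  have haeval (y : L) : aeval y p = ∏ i, (y - x i) := by
    rw [aeval_def, ← eval_map, hp, eval_prod]
    simp
  have hex (σ : Gal(L/F)) (i : ι) : ∃ j, x j = σ (x i) := by
    have h0 : aeval (σ (x i)) p = 0 := by
      rw [← AlgEquiv.coe_toAlgHom, aeval_algHom_apply, haeval,
        Finset.prod_eq_zero (Finset.mem_univ i) (sub_self _), map_zero]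
    rw [haeval, Finset.prod_eq_zero_iff] at h0
    obtain ⟨j, -, hj⟩ := h0
    exact ⟨j, (sub_eq_zero.mp hj).symm⟩
  choose f hf using hex
  let ψ : Gal(L/F) →* Function.End ι :=
    { toFun := f
      map_one' := funext fun i => hx (by rw [hf]; rfl)
      map_mul' := fun σ τ => funext fun i => hx (by
        change x (f (σ * τ) i) = x (f σ (f τ i))
        rw [hf, hf, hf]; rfl) }
  exact ⟨ψ.toHomPerm, fun σ i => hf σ i⟩

/-- A separable irreducible quartic whose resolvent cubic is irreducible with nonsquare
discriminant has Galois group `S₄`. -/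
theorem quartic_gal_mulEquiv_perm {F : Type*} [Field F] {b c d e : F} {p : F[X]}
    (hp : p = X ^ 4 + C b * X ^ 3 + C c * X ^ 2 + C d * X + C e)
    (hirr : Irreducible p) (hsep : p.Separable)
    (hres : Irreducible (quarticResolvent b c d e).toPoly)
    (hdiscr : ¬ IsSquare (quarticResolvent b c d e).discr) :
    Nonempty (p.Gal ≃* Equiv.Perm (Fin 4)) := by
  have hdeg : p.natDegree = 4 := by rw [hp]; compute_degree!
  have hmonic : p.Monic := by rw [hp]; monicity!
  let L := p.SplittingField
  have hsplits : (p.map (algebraMap F L)).Splits := SplittingField.splits p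
  have hcard : Fintype.card (p.rootSet L) = 4 := by
    rw [card_rootSet_eq_natDegree hsep hsplits, hdeg]
  let ε : Fin 4 ≃ p.rootSet L := (Fintype.equivFinOfCardEq hcard).symm
  let x : Fin 4 → L := fun i => ε i
  have hx : Function.Injective x := Subtype.val_injective.comp ε.injective
  have hprod : p.map (algebraMap F L) = ∏ i, (X - C (x i)) := by
    symm
    refine eq_of_dvd_of_natDegree_le_of_leadingCoeff ?_ ?_ ?_
    · refine Finset.prod_dvd_of_coprime ?_ ?_
      · intro i _ j _ hij
        exact pairwise_coprime_X_sub_C hx hij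
      · intro i _
        rw [dvd_iff_isRoot, IsRoot, eval_map, ← aeval_def]
        exact aeval_eq_zero_of_mem_rootSet (ε i).2
    · rw [natDegree_map, hdeg, natDegree_prod_of_monic _ _ fun i _ => monic_X_sub_C _]
      simp
    · rw [(monic_prod_X_sub_C _ _).leadingCoeff, (hmonic.map _).leadingCoeff]
  have hprod' : X ^ 4 + C (algebraMap F L b) * X ^ 3 + C (algebraMap F L c) * X ^ 2 +
      C (algebraMap F L d) * X + C (algebraMap F L e) = ∏ i, (X - C (x i)) := by
    rw [← hprod, congrArg (Polynomial.map (algebraMap F L)) hp]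
    simp
  have hmap := map_quarticResolvent (algebraMap F L) b c d e
  have : IsGalois F L := IsGalois.of_separable_splitting_field hsep
  obtain ⟨φ, hφ⟩ := exists_galois_perm_hom hx hprod
  have hinj : Function.Injective φ := by
    intro σ τ h
    refine Polynomial.Gal.ext p fun y hy => ?_
    obtain ⟨i, hi⟩ := ε.surjective ⟨y, hy⟩
    have hxi : x i = y := congrArg Subtype.val hi
    have := hφ σ i
    rw [h, hφ τ i, hxi] at this
    exact this.symm
  have hcardG : Nat.card Gal(L/F) = Module.finrank F L := IsGalois.card_aut_eq_finrank F L
  have h4 : 4 ∣ Module.finrank F L := by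
    rw [← hdeg]
    exact hmonic.natDegree_dvd_finrank_of_irreducible hirr
      (aeval_eq_zero_of_mem_rootSet (ε 0).2)
  have h3 : 3 ∣ Module.finrank F L := by
    have hd3 : (quarticResolvent b c d e).toPoly.natDegree = 3 :=
      Cubic.natDegree_of_a_ne_zero one_ne_zero
    have hm3 : (quarticResolvent b c d e).toPoly.Monic := Cubic.monic_of_a_eq_one rfl
    rw [← hd3]
    refine hm3.natDegree_dvd_finrank_of_irreducible hres (y := x 0 * x 1 + x 2 * x 3) ?_
    rw [aeval_def, ← eval_map, ← Cubic.map_toPoly, hmap]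
    exact eval_quarticResolvent_eq_zero hprod'
  have h12 : 12 ∣ Nat.card φ.range := by
    rw [Nat.card_congr (φ.ofInjective hinj).toEquiv.symm, hcardG]
    exact Nat.Coprime.mul_dvd_of_dvd_of_dvd (by norm_num : Nat.Coprime 3 4) h3 h4
  have hindex : φ.range.index * Nat.card φ.range = 24 := by
    rw [Subgroup.index_mul_card, Nat.card_perm, Nat.card_fin]
    rfl
  have hne2 : φ.range.index ≠ 2 := by
    intro h2
    have halt := Equiv.Perm.eq_alternatingGroup_of_index_eq_two h2
    have hfix (σ : Gal(L/F)) : σ (Matrix.vandermonde x).det = (Matrix.vandermonde x).det := by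
      have hsign : Equiv.Perm.sign (φ σ) = 1 := by
        rw [← Equiv.Perm.mem_alternatingGroup, ← halt]
        exact ⟨σ, rfl⟩
      have hperm := Matrix.det_permute (φ σ) (Matrix.vandermonde x)
      rw [hsign, Units.val_one, Int.cast_one, one_mul] at hperm
      rw [← AlgEquiv.coe_ringEquiv, ← RingEquiv.coe_toRingHom, RingHom.map_det]
      rw [← hperm]
      congr 1
      ext i j
      simp [Matrix.vandermonde_apply, hφ]
    obtain ⟨δ, hδ⟩ := (IsGalois.mem_range_algebraMap_iff_fixed _).mpr hfix
    refine hdiscr ⟨δ, (algebraMap F L).injective ?_⟩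
    have hsq := discr_quarticResolvent_eq hprod'
    rwa [← hδ, ← hmap, Cubic.discr_map, pow_two, ← map_mul] at hsq
  have hsurj : Function.Surjective φ := by
    rw [← MonoidHom.range_eq_top, ← Subgroup.index_eq_one]
    obtain ⟨k, hk⟩ := h12
    rw [hk] at hindex
    have hdvd : φ.range.index * k = 2 := by linarith
    have hle := Nat.le_of_dvd two_pos (Dvd.intro k hdvd)
    interval_cases φ.range.index <;> simp_all
  exact ⟨MulEquiv.ofBijective φ ⟨hinj, hsurj⟩⟩

theorem quartic_family_no_int_root (a r : ℤ) : r ^ 4 + a * r ^ 3 + (1 - a) * r - 1 ≠ 0 := by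
  intro h
  have hu : r * (r ^ 3 + a * r ^ 2 + (1 - a)) = 1 := by linear_combination h
  rcases Int.eq_one_or_neg_one_of_mul_eq_one hu with rfl | rfl <;> ring_nf at h <;> omega

theorem quartic_family_no_int_quadratic_factor {a u v s t : ℤ} (h3 : a = u + s)
    (h2 : 0 = v + t + u * s) (h1 : 1 - a = u * t + v * s) (h0 : -1 = v * t) : False := by
  have hv : v * -t = 1 := by linarith
  have hvt : v = 1 ∧ t = -1 ∨ v = -1 ∧ t = 1 := by
    rcases Int.eq_one_or_neg_one_of_mul_eq_one hv with rfl | rfl <;> omega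
  have hus : u = 0 ∨ s = 0 := by
    rw [← mul_eq_zero]
    omega
  rcases hvt with ⟨rfl, rfl⟩ | ⟨rfl, rfl⟩ <;> rcases hus with rfl | rfl <;> omega

theorem quartic_family_irreducible (a : ℤ) :
    Irreducible (X ^ 4 + C (a : ℚ) * X ^ 3 + C (1 - (a : ℚ)) * X - 1) := by
  let p : ℤ[X] := X ^ 4 + C a * X ^ 3 + C 0 * X ^ 2 + C (1 - a) * X + C (-1)
  have hdeg : p.natDegree = 4 := by simp only [p]; compute_degree!
  have hmonic : p.Monic := by simp only [p]; monicity!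
  have hmap : p.map (algebraMap ℤ ℚ) =
      X ^ 4 + C (a : ℚ) * X ^ 3 + C (1 - (a : ℚ)) * X - 1 := by
    simp [p, sub_eq_add_neg]
  rw [← hmap, ← hmonic.irreducible_iff_irreducible_map_fraction_map,
    hmonic.irreducible_iff_lt_natDegree_lt (fun h => by simp [h] at hdeg)]
  intro q hq hqdeg hdvd
  rw [hdeg, Finset.mem_Ioc] at hqdeg
  obtain h1 | h2 : q.natDegree = 1 ∨ q.natDegree = 2 := by omega
  · have hroot : p.IsRoot (-q.coeff 0) := by
      refine IsRoot.dvd ?_ hdvd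
      rw [hq.eq_X_add_C h1]
      simp
    apply quartic_family_no_int_root a (-q.coeff 0)
    simpa [p, sub_eq_add_neg] using hroot
  · obtain ⟨r, hr⟩ := hdvd
    have hrm : r.Monic := hq.of_mul_monic_left (hr ▸ hmonic)
    have hrdeg : r.natDegree = 2 := by
      have := hq.natDegree_mul hrm
      rw [← hr] at this
      omega
    have hq' := hq.as_sum
    have hr' := hrm.as_sum
    simp only [h2, hrdeg, Finset.sum_range_succ, Finset.sum_range_zero] at hq' hr'
    obtain ⟨h3, h2, h1, h0⟩ := monic_quartic_coeffs_eq (b' := q.coeff 1 + r.coeff 1)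
      (c' := q.coeff 0 + r.coeff 0 + q.coeff 1 * r.coeff 1)
      (d' := q.coeff 1 * r.coeff 0 + q.coeff 0 * r.coeff 1) (e' := q.coeff 0 * r.coeff 0)
      (hr.trans ((congrArg₂ (· * ·) hq' hr').trans (by
        simp only [map_add, map_mul]
        ring)))
    exact quartic_family_no_int_quadratic_factor h3 h2 h1 h0

/-- The resolvent cubic of the family has integral roots only for small `a`. -/
theorem abs_le_of_resolvent_int_root {a y : ℤ}
    (h : y ^ 3 + (a * (1 - a) + 4) * y + (2 * a - 1) = 0) :
    |a| ≤ 100 := by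
  have hsq : (2 * y * a - (y + 2)) ^ 2 = 4 * y ^ 4 + 17 * y ^ 2 + 4 := by
    linear_combination (-4 * y) * h
  have hy : y ^ 2 ≤ 12 := by
    by_contra! hlt
    have hlo : |2 * y ^ 2 + 4| < |2 * y * a - (y + 2)| := sq_lt_sq.mp (by nlinarith)
    have hhi : |2 * y * a - (y + 2)| < |2 * y ^ 2 + 5| := sq_lt_sq.mp (by nlinarith)
    rw [abs_of_pos (by positivity : 0 < 2 * y ^ 2 + 4)] at hlo
    rw [abs_of_pos (by positivity : 0 < 2 * y ^ 2 + 5)] at hhi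
    omega
  have hy1 : -3 ≤ y := by nlinarith
  have hy2 : y ≤ 3 := by nlinarith
  rw [abs_le]
  constructor <;> interval_cases y <;> first | omega | nlinarith

/-- The discriminant of the resolvent cubic of the family is a square only for small `a`: its
square root would lie too close to `(2t³ - 51t) / 8`, where `t = 2a - 1`. -/
theorem abs_le_of_resolvent_discr_isSquare {a : ℤ}
    (h : IsSquare (-4 * (a * (1 - a) + 4) ^ 3 - 27 * (2 * a - 1) ^ 2)) : |a| ≤ 500 := by
  obtain ⟨w, hw⟩ := h
  by_contra! hlt
  set T := |2 * a - 1| with hT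
  have hTlarge : 1000 ≤ T := by
    rw [hT]
    rcases lt_abs.mp hlt with h | h
    · exact le_abs.mpr (Or.inl (by omega))
    · exact le_abs.mpr (Or.inr (by omega))
  have hTsq : T ^ 2 = (2 * a - 1) ^ 2 := sq_abs _
  have hkey : (8 * w) ^ 2 = (2 * T ^ 3 - 51 * T) ^ 2 - 861 * T ^ 2 - 19652 := by
    have hpow : (2 * T ^ 3 - 51 * T) ^ 2 = T ^ 2 * (2 * T ^ 2 - 51) ^ 2 := by ring
    rw [hpow, hTsq]
    linear_combination -64 * hw
  have hM : 0 < 2 * T ^ 3 - 51 * T := by nlinarith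
  have hhi : |8 * w| < |2 * T ^ 3 - 51 * T| := sq_lt_sq.mp (by nlinarith)
  have hlo : |2 * T ^ 3 - 51 * T - 1| < |8 * w| := by
    refine sq_lt_sq.mp ?_
    rw [hkey]
    nlinarith [mul_nonneg (sq_nonneg T) (sub_nonneg.mpr hTlarge)]
  rw [abs_of_pos hM] at hhi
  rw [abs_of_nonneg (by omega)] at hlo
  omega

theorem resolvent_irreducible {a : ℤ} (ha : 100 < |a|) :
    Irreducible (quarticResolvent (a : ℚ) 0 (1 - a) (-1)).toPoly := by
  have hd3 : (quarticResolvent (a : ℚ) 0 (1 - a) (-1)).toPoly.natDegree = 3 :=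
    Cubic.natDegree_of_a_ne_zero one_ne_zero
  have hm3 : (quarticResolvent a 0 (1 - a) (-1)).toPoly.Monic := Cubic.monic_of_a_eq_one rfl
  have hmap : (quarticResolvent (a : ℚ) 0 (1 - a) (-1)).toPoly =
      (quarticResolvent a 0 (1 - a) (-1)).toPoly.map (algebraMap ℤ ℚ) := by
    rw [← Cubic.map_toPoly, map_quarticResolvent]
    simp
  rw [irreducible_iff_roots_eq_zero_of_degree_le_three (by omega) (by omega)]
  refine Multiset.eq_zero_of_forall_notMem fun y hy => ?_
  have hroot := isRoot_of_mem_roots hy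
  rw [hmap, IsRoot, eval_map, ← aeval_def] at hroot
  obtain ⟨z, rfl⟩ := isInteger_of_is_root_of_monic hm3 hroot
  rw [aeval_algebraMap_apply, map_eq_zero_iff _ (algebraMap ℤ ℚ).injective_int] at hroot
  refine ha.not_ge (abs_le_of_resolvent_int_root (y := z) ?_)
  simp [quarticResolvent, Cubic.toPoly] at hroot
  linear_combination hroot

/-- For all but finitely many integers `a`, the polynomial `X⁴ + aX³ + (1 − a)X − 1` is
irreducible over `ℚ` and the Galois group of its splitting field over `ℚ` is isomorphic
to the symmetric group `S₄` on four letters. -/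
theorem quartic_family_galois_S4 :
    {a : ℤ | ¬ (Irreducible (X ^ 4 + C (a : ℚ) * X ^ 3 + C (1 - (a : ℚ)) * X - 1) ∧
      Nonempty ((X ^ 4 + C (a : ℚ) * X ^ 3 + C (1 - (a : ℚ)) * X - 1).Gal ≃*
        Equiv.Perm (Fin 4)))}.Finite := by
  refine (Set.finite_Icc (-500 : ℤ) 500).subset fun a ha => ?_
  rw [Set.mem_Icc, ← abs_le]
  by_contra! hlt
  have hirr := quartic_family_irreducible a
  refine ha ⟨hirr, quartic_gal_mulEquiv_perm (b := (a : ℚ)) (c := 0) (d := 1 - a) (e := -1)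
    (by simp [sub_eq_add_neg]) hirr hirr.separable (resolvent_irreducible (by linarith)) ?_⟩
  intro hsq
  have hdiscr : (quarticResolvent (a : ℚ) 0 (1 - a) (-1)).discr =
      ((-4 * (a * (1 - a) + 4) ^ 3 - 27 * (2 * a - 1) ^ 2 : ℤ) : ℚ) := by
    simp only [quarticResolvent, Cubic.discr]
    push_cast
    ring
  rw [hdiscr, Rat.isSquare_intCast_iff] at hsq
  exact hlt.not_ge (abs_le_of_resolvent_discr_isSquare hsq)
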